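/- There exists a constant c such that for every n ≥ 1, the separation formula Φₙ has a QU-resolution falsity proof from the set of clauses of φₙ whose size is at most c·n. -/

import Mathlib

/-! Framework for quantified Boolean circuits (QBCs), QU-resolution,
relaxations, and the prover–delayer game, following Chen,
"Proof Complexity Modulo the Polynomial Hierarchy". -/

/-- Quantifiers. -/
inductive Quant where
  | all : Quant
  | ex : Quant
deriving DecidableEq

/-- A partial assignment of Boolean values to (numbered) propositional
variables.  Via the correspondence `C ↔ assign(C)`, partial assignments also
represent clauses (the clause `clause(a)` is the unique clause with variable
set `dom a` falsified by `a`); we freely identify the two. -/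
abbrev PA : Type := ℕ → Option Bool

/-- The everywhere-undefined partial assignment (= the empty clause). -/
def emptyPA : PA := fun _ => none

/-- `g` extends the partial assignment `f`. -/
def ExtendsPA (g f : PA) : Prop := ∀ v b, f v = some b → g v = some b

/-- A total assignment `g` extends a partial assignment `f`; when `f`
represents a clause, this says `g` falsifies that clause. -/
def TotalExtends (g : ℕ → Bool) (f : PA) : Prop := ∀ v b, f v = some b → g v = b

/-- A partial assignment `r` satisfies a clause `C` (i.e. makes some literal
of `C` true). -/
def SatisfiedBy (r : PA) (C : PA) : Prop := ∃ v b, C v = some b ∧ r v = some (!b)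

/-- A quantified Boolean circuit: a quantifier prefix (a list of
quantifier/variable pairs) together with a Boolean function on total
assignments, represented as a predicate. -/
structure QBC where
  pfx : List (Quant × ℕ)
  matrix : (ℕ → Bool) → Prop

/-- The variables of the prefix of a QBC. -/
def QBC.vars (Φ : QBC) : List ℕ := Φ.pfx.map Prod.snd

/-- Well-formedness of a QBC: the prefix has no repeated variables, and the
matrix depends only on the values of the prefix variables. -/
def QBC.WellFormed (Φ : QBC) : Prop :=
  Φ.vars.Nodup ∧
  ∀ f g : ℕ → Bool, (∀ v ∈ Φ.vars, f v = g v) → (Φ.matrix f ↔ Φ.matrix g)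

/-- Standard semantics of a quantifier prefix over a matrix, starting from a
base assignment. -/
def evalQ : List (Quant × ℕ) → ((ℕ → Bool) → Prop) → (ℕ → Bool) → Prop
  | [], φ, g => φ g
  | (Quant.ex, v) :: P, φ, g => ∃ b, evalQ P φ (Function.update g v b)
  | (Quant.all, v) :: P, φ, g => ∀ b, evalQ P φ (Function.update g v b)

/-- Truth of a QBC. -/
def QBC.IsTrue (Φ : QBC) : Prop := ∀ g, evalQ Φ.pfx Φ.matrix g

/-- Falsity of a QBC. -/
def QBC.IsFalse (Φ : QBC) : Prop := ¬ Φ.IsTrue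

/-- The existentially quantified variables of a prefix. -/
def existVars (P : List (Quant × ℕ)) : List ℕ :=
  (P.filter fun p => decide (p.1 = Quant.ex)).map Prod.snd

/-- The universally quantified variables of a prefix. -/
def univVars (P : List (Quant × ℕ)) : List ℕ :=
  (P.filter fun p => decide (p.1 = Quant.all)).map Prod.snd

/-- The relation `u ⪯ v` of a prefix: `vᵢ ⪯ vⱼ` iff `i ≤ j`, or `j < i` and
`Qⱼ = Qⱼ₊₁ = ⋯ = Qᵢ`. -/
def preceq (P : List (Quant × ℕ)) (u v : ℕ) : Prop :=
  ∃ i j : ℕ, (P[i]?).map Prod.snd = some u ∧ (P[j]?).map Prod.snd = some v ∧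
    (i ≤ j ∨ (j < i ∧ ∀ k, j ≤ k → k ≤ i → (P[k]?).map Prod.fst = (P[j]?).map Prod.fst))

/-- `u` strictly precedes `v` (`u ⪯ v` and not `v ⪯ u`). -/
def strictPrec (P : List (Quant × ℕ)) (u v : ℕ) : Prop :=
  preceq P u v ∧ ¬ preceq P v u

/-- dom(f) ⪯ y : every variable on which `f` is defined is `⪯ y`. -/
def domPrec (P : List (Quant × ℕ)) (f : PA) (y : ℕ) : Prop :=
  ∀ u, f u ≠ none → preceq P u y

/-- An ∃-strategy: a family of response functions for the existential
variables, each depending only on the universal variables strictly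
preceding it. -/
def IsExStrategy (Φ : QBC) (σ : ℕ → (ℕ → Bool) → Bool) : Prop :=
  ∀ x ∈ existVars Φ.pfx, ∀ τ τ' : ℕ → Bool,
    (∀ y ∈ univVars Φ.pfx, strictPrec Φ.pfx y x → τ y = τ' y) → σ x τ = σ x τ'

/-- The total assignment `⟨σ, τ⟩` induced by an ∃-strategy `σ` and an
assignment `τ` to the universal variables. -/
def playE (Φ : QBC) (σ : ℕ → (ℕ → Bool) → Bool) (τ : ℕ → Bool) : ℕ → Bool :=
  fun v => if v ∈ existVars Φ.pfx then σ v τ else τ v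

/-- `σ` is a winning ∃-strategy of the prefix of `Φ` for the matrix `M`. -/
def ModelOf (Φ : QBC) (M : (ℕ → Bool) → Prop) (σ : ℕ → (ℕ → Bool) → Bool) : Prop :=
  IsExStrategy Φ σ ∧ ∀ τ : ℕ → Bool, M (playE Φ σ τ)

/-- A model of `Φ` (a winning ∃-strategy). -/
def QBC.Model (Φ : QBC) (σ : ℕ → (ℕ → Bool) → Bool) : Prop :=
  ModelOf Φ Φ.matrix σ

/-- `σ` is a model of `P : C`, where `P` is the prefix of `Φ` and `C` is a
clause (represented by its falsifying assignment). -/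
def ModelOfClause (Φ : QBC) (σ : ℕ → (ℕ → Bool) → Bool) (C : PA) : Prop :=
  ModelOf Φ (fun g => ¬ TotalExtends g C) σ

/-- `C` is an axiom of `Φ`: a clause on the variables of `Φ` such that every
model of `Φ` is a model of `P : C`. -/
def IsAxiom (Φ : QBC) (C : PA) : Prop :=
  (∀ v, C v ≠ none → v ∈ Φ.vars) ∧ ∀ σ, Φ.Model σ → ModelOfClause Φ σ C

/-- An axiom set of `Φ`. -/
def IsAxiomSet (Φ : QBC) (H : Set PA) : Prop := ∀ C ∈ H, IsAxiom Φ C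

/-- A ∀-strategy: response functions for the universal variables, each
depending only on the existential variables strictly preceding it. -/
def IsUnivStrategy (Φ : QBC) (τ : ℕ → (ℕ → Bool) → Bool) : Prop :=
  ∀ y ∈ univVars Φ.pfx, ∀ σ σ' : ℕ → Bool,
    (∀ x ∈ existVars Φ.pfx, strictPrec Φ.pfx x y → σ x = σ' x) → τ y σ = τ y σ'

/-- The total assignment `⟨τ, σ⟩` induced by a ∀-strategy `τ` and an
assignment `σ` to the existential variables. -/
def playU (Φ : QBC) (τ : ℕ → (ℕ → Bool) → Bool) (σ : ℕ → Bool) : ℕ → Bool :=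
  fun v => if v ∈ univVars Φ.pfx then τ v σ else σ v

/-- A winning ∀-strategy: every play falsifies the matrix. -/
def WinningUnivStrategy (Φ : QBC) (τ : ℕ → (ℕ → Bool) → Bool) : Prop :=
  IsUnivStrategy Φ τ ∧ ∀ σ : ℕ → Bool, ¬ Φ.matrix (playU Φ τ σ)

/-- `C` is obtainable from `D` by ∀-elimination (relative to prefix `P`):
`C = D ∖ {L}` for a literal `L` on a universal variable `y` with
`vars(C) ⪯ y`.  In assignment form: `D` is `C` additionally defined on `y`. -/
def ForallElim (P : List (Quant × ℕ)) (C D : PA) : Prop :=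
  ∃ y b, y ∈ univVars P ∧ C y = none ∧ D = Function.update C y (some b) ∧
    ∀ u, C u ≠ none → preceq P u y

/-- `γ` is the resolvent of `α` and `β` on variable `v` (in falsifying
assignment form: `α` and `β` carry complementary literals on `v`, `γ` is
the union of the remainders, which must be a clause). -/
def IsResolvent (γ α β : PA) (v : ℕ) : Prop :=
  ∃ b, α v = some b ∧ β v = some (!b) ∧ γ v = none ∧
    (∀ u, u ≠ v → γ u = (α u).elim (β u) some) ∧
    (∀ u, u ≠ v → ∀ b₁ b₂, α u = some b₁ → β u = some b₂ → b₁ = b₂)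

/-- A step in a QU-resolution proof: an axiom, a ∀-elimination (annotated with
the index of its source), or a resolution step (annotated with the indices of
its two sources and the resolved variable). -/
inductive QUStep where
  | ax (C : PA)
  | elim (C : PA) (src : ℕ)
  | res (C : PA) (src₁ src₂ : ℕ) (v : ℕ)

/-- The clause of a proof step. -/
def QUStep.clause : QUStep → PA
  | .ax C => C
  | .elim C _ => C
  | .res C _ _ _ => C

/-- The clause at position `i` of a proof. -/
def stepClause? (L : List QUStep) (i : ℕ) : Option PA := (L[i]?).map QUStep.clause

/-- Validity of the `i`-th step of a proof from axiom set `H`. -/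
def validStep (P : List (Quant × ℕ)) (H : Set PA) (L : List QUStep) (i : ℕ) : Prop :=
  match L[i]? with
  | none => True
  | some (.ax C) => C ∈ H
  | some (.elim C j) => j < i ∧ ∃ D, stepClause? L j = some D ∧ ForallElim P C D
  | some (.res C j k v) => j < i ∧ k < i ∧
      ∃ α β, stepClause? L j = some α ∧ stepClause? L k = some β ∧ IsResolvent C α β v

/-- A QU-resolution proof of `Φ` from axiom set `H`. -/
def IsQUProof (Φ : QBC) (H : Set PA) (L : List QUStep) : Prop :=
  ∀ i, validStep Φ.pfx H L i

/-- A QU-resolution falsity proof: a proof ending with the empty clause. -/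
def IsFalsityProof (Φ : QBC) (H : Set PA) (L : List QUStep) : Prop :=
  IsQUProof Φ H L ∧ (L.getLast?).map QUStep.clause = some emptyPA

/-- The clause `C` appears in the proof `L`. -/
def AppearsIn (L : List QUStep) (C : PA) : Prop := ∃ i, stepClause? L i = some C

/-- The edge relation of the graph `G(π)`: an edge from each clause occurrence
to the clause occurrence(s) from which it is derived. -/
def edge (L : List QUStep) (i j : ℕ) : Prop :=
  match L[i]? with
  | some (.elim _ s) => j = s
  | some (.res _ s t _) => j = s ∨ j = t
  | _ => False

/-- A sink (leaf) of `G(π)`: a vertex with no outgoing edges. -/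
def isSink (L : List QUStep) (i : ℕ) : Prop := i < L.length ∧ ∀ j, ¬ edge L i j

/-- The proof is tree-like: `G(π)` is a tree (each vertex has at most one
incoming edge; acyclicity holds automatically since edges decrease indices). -/
def TreeLike (L : List QUStep) : Prop := ∀ j : ℕ, {i | edge L i j}.Subsingleton

-- The prefix `P[a]`: the variables of `dom a` are removed, and the
-- quantifier of every variable strictly preceding some variable of `dom a`
-- (equivalently, every `v` with `v ⪯ last(a)` and not `last(a) ⪯ v`) is
-- changed to `∃`.
open Classical in
noncomputable def instPrefix (P : List (Quant × ℕ)) (a : PA) : List (Quant × ℕ) :=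
  (P.filter fun p => (a p.2).isNone).map fun p =>
    (if ∃ u, a u ≠ none ∧ strictPrec P p.2 u then Quant.ex else p.1, p.2)

/-- Overriding a total assignment by a partial assignment. -/
def override (a : PA) (g : ℕ → Bool) : ℕ → Bool := fun v => (a v).getD (g v)

/-- The instantiated QBC `Φ[a]` = `P[a] : φ[a]`. -/
noncomputable def QBC.inst (Φ : QBC) (a : PA) : QBC :=
  ⟨instPrefix Φ.pfx a, fun g => Φ.matrix (override a g)⟩

/-- `P'` is a relaxation of the prefix `P`: a permutation of `P` such that
`y ⪯ x` implies `y ⪯' x` for every universal `y` and existential `x`. -/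
def IsRelaxationPfx (P P' : List (Quant × ℕ)) : Prop :=
  P.Perm P' ∧ ∀ y ∈ univVars P, ∀ x ∈ existVars P, preceq P y x → preceq P' y x

/-- `Φ'` is a relaxation of the QBC `Φ`. -/
def IsRelaxation (Φ Φ' : QBC) : Prop :=
  IsRelaxationPfx Φ.pfx Φ'.pfx ∧ Φ'.matrix = Φ.matrix

/-- Negation of a quantifier. -/
def Quant.neg : Quant → Quant
  | .all => .ex
  | .ex => .all

/-- `isAltFrom q i qs`: the quantifier string `qs` consists of (at most) `i`
alternating possibly-empty blocks, starting with a block of `q`s. -/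
def isAltFrom : Quant → ℕ → List Quant → Prop
  | _, 0, qs => qs = []
  | q, i + 1, qs => ∃ k rest, qs = List.replicate k q ++ rest ∧ isAltFrom q.neg i rest

/-- The prefix `P` is `Π_i`: its quantifier string lies in `∀*∃*∀*⋯` with `i`
alternating starred blocks beginning with `∀*`. -/
def isPiPrefix (i : ℕ) (P : List (Quant × ℕ)) : Prop :=
  isAltFrom Quant.all i (P.map Prod.fst)

/-- The axiom set `H(Φ, Π_k)`: the clauses `C` on variables of `Φ` such that
some `Π_k`-relaxation of `Φ[assign(C)]` is false. -/
def Hset (Φ : QBC) (k : ℕ) : Set PA :=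
  {C | (∀ v, C v ≠ none → v ∈ Φ.vars) ∧
    ∃ Φ' : QBC, IsRelaxation (Φ.inst C) Φ' ∧ isPiPrefix k Φ'.pfx ∧ Φ'.IsFalse}

/-- `g` is a semicompletion of `f` (relative to prefix `P`). -/
def SemiComp (P : List (Quant × ℕ)) (f g : PA) : Prop :=
  ExtendsPA g f ∧
  ∀ y ∈ univVars P, f y = none → domPrec P f y → (g y = none ∧ domPrec P g y)

/-- A set of partial assignments of `Φ` is semicompletion-closed. -/
def SemiCompClosed (Φ : QBC) (H : Set PA) : Prop :=
  ∀ f ∈ H, ∀ g : PA, (∀ v, g v ≠ none → v ∈ Φ.vars) → SemiComp Φ.pfx f g → g ∈ H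

/-- Delayer condition (semicompletion-of-empty). -/
def CondEmpty (Φ : QBC) (F : Set PA) (s : PA → ℕ) : Prop :=
  ∃ g ∈ F, SemiComp Φ.pfx emptyPA g ∧ s g = 0

/-- Delayer condition (monotonicity). -/
def CondMono (Φ : QBC) (F : Set PA) (s : PA → ℕ) : Prop :=
  ∀ g ∈ F, ∀ f' : PA, ExtendsPA g f' → ∃ f ∈ F, SemiComp Φ.pfx f' f ∧ s f ≤ s g

/-- Delayer condition (∀-branching). -/
def CondForallB (Φ : QBC) (F : Set PA) (s : PA → ℕ) : Prop :=
  ∀ f ∈ F, ∀ y ∈ univVars Φ.pfx, f y = none → domPrec Φ.pfx f y →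
    ∀ b : Bool, ∃ g ∈ F, SemiComp Φ.pfx (Function.update f y (some b)) g ∧ s g = s f

/-- Delayer condition (double-branching). -/
def CondDoubleB (Φ : QBC) (F : Set PA) (s : PA → ℕ) : Prop :=
  ∀ f ∈ F, ∀ v ∈ Φ.vars, f v = none →
    ∃ b : Bool, ∃ g ∈ F, SemiComp Φ.pfx (Function.update f v (some b)) g ∧
      s g ≤ s f + 1 ∧
      (s g = s f + 1 →
        ∃ g' ∈ F, SemiComp Φ.pfx (Function.update f v (some (!b))) g' ∧ s g' ≤ s f + 1)

/-- A `p`-point delayer strategy for `Φ` with respect to axiom set `H`. -/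
def IsDelayer (Φ : QBC) (H : Set PA) (p : ℕ) (F : Set PA) (s : PA → ℕ) : Prop :=
  (∀ f ∈ F, ∀ v, f v ≠ none → v ∈ Φ.vars) ∧
  CondEmpty Φ F s ∧ (∀ f ∈ F, f ∈ H → p ≤ s f) ∧
  CondMono Φ F s ∧ CondForallB Φ F s ∧ CondDoubleB Φ F s

/-! The separation formulas `Φₙ` of Section 6. -/

/-- The variable `x_{i,j,k}`. -/
def xV (i : ℕ) (j k : Bool) : ℕ := 9 * i + 2 * cond j 1 0 + cond k 1 0

/-- The variable `x'_{i,j,k}`. -/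
def xV' (i : ℕ) (j k : Bool) : ℕ := 9 * i + 4 + 2 * cond j 1 0 + cond k 1 0

/-- The variable `yᵢ`. -/
def yV (i : ℕ) : ℕ := 9 * i + 8

/-- A block of four quantified variables. -/
def blockOf (q : Quant) (f : Bool → Bool → ℕ) : List (Quant × ℕ) :=
  [(q, f false false), (q, f false true), (q, f true false), (q, f true true)]

/-- The prefix `∃X₀ ∃X'₁∀y₁∃X₁ ⋯ ∃X'ₙ∀yₙ∃Xₙ`. -/
def sepPrefix (n : ℕ) : List (Quant × ℕ) :=
  blockOf Quant.ex (xV 0) ++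
    (List.range n).flatMap fun i =>
      blockOf Quant.ex (xV' (i + 1)) ++ [(Quant.all, yV (i + 1))] ++
        blockOf Quant.ex (xV (i + 1))

/-- The clause `¬x_{0,j,k}` (as its falsifying assignment). -/
def clB1 (j k : Bool) : PA := fun v => if v = xV 0 j k then some true else none

/-- The clause `x_{n,j,0} ∨ x_{n,j,1}`. -/
def clB2 (n : ℕ) (j : Bool) : PA :=
  fun v => if v = xV n j false ∨ v = xV n j true then some false else none

/-- The clause `¬x'_{i,0,k} ∨ ¬x'_{i,1,l} ∨ x_{i−1,j,0} ∨ x_{i−1,j,1}`. -/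
def clH (i : ℕ) (j k l : Bool) : PA := fun v =>
  if v = xV' i false k ∨ v = xV' i true l then some true
  else if v = xV (i - 1) j false ∨ v = xV (i - 1) j true then some false
  else none

/-- For `j = false` the clause `¬x_{i,0,k} ∨ yᵢ ∨ x'_{i,0,k}`; for `j = true`
the clause `¬x_{i,1,k} ∨ ¬yᵢ ∨ x'_{i,1,k}`. -/
def clT (i : ℕ) (j k : Bool) : PA := fun v =>
  if v = xV i j k then some true
  else if v = yV i then some j
  else if v = xV' i j k then some false
  else none

/-- The set `Tᵢ` of clauses. -/
def Tset (i : ℕ) : Set PA := {C | ∃ j k : Bool, C = clT i j k}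

/-- The set of clauses of the matrix `φₙ`. -/
def sepClauses (n : ℕ) : Set PA :=
  {C | (∃ j k : Bool, C = clB1 j k) ∨ (∃ j : Bool, C = clB2 n j) ∨
    (∃ i, 1 ≤ i ∧ i ≤ n ∧ ∃ j k l : Bool, C = clH i j k l) ∨
    (∃ i, 1 ≤ i ∧ i ≤ n ∧ ∃ j k : Bool, C = clT i j k)}

/-- The separation formula `Φₙ`. -/
def sepQBC (n : ℕ) : QBC :=
  ⟨sepPrefix n, fun g => ∀ C ∈ sepClauses n, ¬ TotalExtends g C⟩

/-- The level-`i` variables `X'ᵢ ∪ {yᵢ} ∪ Xᵢ`. -/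
def levelVars (i : ℕ) : List ℕ :=
  [xV' i false false, xV' i false true, xV' i true false, xV' i true true, yV i,
   xV i false false, xV i false true, xV i true false, xV i true true]

/-- `r` is defined exactly on the level-`i` variables. -/
def OnLevel (i : ℕ) (r : PA) : Prop := ∀ v, r v ≠ none ↔ v ∈ levelVars i

/-- A normal realization of level `i`. -/
def NormalReal (i : ℕ) (r : PA) : Prop :=
  OnLevel i r ∧ ∃ b : Bool, r (yV i) = some b ∧
    r (xV i b false) = some false ∧ r (xV' i b false) = some false ∧
    r (xV i b true) = some false ∧ r (xV' i b true) = some false ∧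
    ∃ c : Bool, r (xV i (!b) false) = some c ∧ r (xV' i (!b) false) = some c ∧
      r (xV i (!b) true) = some (!c) ∧ r (xV' i (!b) true) = some (!c)

/-- A funny realization of level `i`. -/
def FunnyReal (i : ℕ) (r : PA) : Prop :=
  OnLevel i r ∧ ∃ b : Bool, r (yV i) = some b ∧
    (∃ c : Bool, r (xV i b false) = some c ∧ r (xV' i b false) = some c ∧
      r (xV i b true) = some (!c) ∧ r (xV' i b true) = some (!c)) ∧
    r (xV' i (!b) false) = some false ∧ r (xV' i (!b) true) = some false ∧
    ∃ d : Bool, r (xV i (!b) false) = some d ∧ r (xV i (!b) true) = some (!d)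

/-- Restriction of a partial assignment to the level-`i` variables. -/
def restrictLevel (i : ℕ) (f : PA) : PA :=
  fun v => if v ∈ levelVars i then f v else none

-- The maximum level `ℓ` containing an existentially quantified variable of
-- `dom f` (and `0` if there is none).
open Classical in
noncomputable def maxLevel (n : ℕ) (f : PA) : ℕ :=
  ((Finset.Icc 1 n).filter fun i => ∃ v ∈ levelVars i, v ≠ yV i ∧ f v ≠ none).sup id

/-- `f` is half-defined on level `ℓ`. -/
def HalfDefined (ℓ : ℕ) (f : PA) : Prop :=
  (∀ j k : Bool, f (xV ℓ j k) = none) ∧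
  (∃ j k : Bool, f (xV' ℓ j k) = some true ∧
    ∀ j' k' : Bool, (j', k') ≠ (j, k) → f (xV' ℓ j' k') = some false)

/-- A normal assignment of `Φₙ`. -/
def NormalAssign (n : ℕ) (f : PA) : Prop :=
  (∀ v, f v ≠ none → v ∈ (sepPrefix n).map Prod.snd) ∧
  (∀ j k : Bool, f (xV 0 j k) = some false) ∧
  (∀ i, 1 ≤ i → i + 1 ≤ maxLevel n f → NormalReal i (restrictLevel i f)) ∧
  (1 ≤ maxLevel n f →
    (NormalReal (maxLevel n f) (restrictLevel (maxLevel n f) f) ∨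
      HalfDefined (maxLevel n f) f))

/-- A funny assignment of `Φₙ`, with witness `m` (so that `sₙ(f) = m`). -/
def FunnyAssign (n : ℕ) (f : PA) (m : ℕ) : Prop :=
  (∀ v, f v ≠ none → v ∈ (sepPrefix n).map Prod.snd) ∧
  1 ≤ m ∧ m ≤ maxLevel n f ∧
  (∀ j k : Bool, f (xV 0 j k) = some false) ∧
  (∀ i, 1 ≤ i → i < m → NormalReal i (restrictLevel i f)) ∧
  FunnyReal m (restrictLevel m f) ∧
  (∀ i, m < i → i ≤ maxLevel n f → ∀ j : Bool,
    ((f (xV i j false) ≠ none ∨ f (xV i j true) ≠ none ∨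
      f (xV' i j false) ≠ none ∨ f (xV' i j true) ≠ none) →
      ∃ c : Bool, f (xV i j false) = some c ∧ f (xV' i j false) = some c ∧
        f (xV i j true) = some (!c) ∧ f (xV' i j true) = some (!c)))

/-- The set `Fₙ` of normal and funny assignments. -/
def Fset (n : ℕ) : Set PA := {f | NormalAssign n f ∨ ∃ m, FunnyAssign n f m}

-- The score function `sₙ`.
open Classical in
noncomputable def score (n : ℕ) (f : PA) : ℕ :=
  if h : ∃ m, FunnyAssign n f m then h.choose else maxLevel n f

/-! The mod-3 formulas `Ψₙ` of Section 7 (variables `xᵢ = 2i`, `yᵢ = 2i+1`). -/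

/-- The prefix `∃x₁∀y₁⋯∃xₙ∀yₙ`. -/
def modPrefix (n : ℕ) : List (Quant × ℕ) :=
  (List.range n).flatMap fun i =>
    [(Quant.ex, 2 * (i + 1)), (Quant.all, 2 * (i + 1) + 1)]

/-- Numeric value of a Boolean. -/
def boolVal (b : Bool) : ℕ := cond b 1 0

/-- The matrix `φ_{n,j}`: true iff `j + Σᵢ (xᵢ + yᵢ) ≢ n (mod 3)`. -/
def modMatrix (n j : ℕ) (g : ℕ → Bool) : Prop :=
  ¬ ((j + ∑ i ∈ Finset.Icc 1 n, (boolVal (g (2 * i)) + boolVal (g (2 * i + 1)))) % 3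
      = n % 3)

/-- The mod-3 formula `Ψₙ`. -/
def modQBC (n : ℕ) : QBC := ⟨modPrefix n, modMatrix n 0⟩


/-- Within `m` steps, a valid proof can contain all clauses of `S`. -/
def Reach (Φ : QBC) (H : Set PA) (m : ℕ) (S : Set PA) : Prop :=
  ∃ L : List QUStep, IsQUProof Φ H L ∧ L.length ≤ m ∧ ∀ C ∈ S, AppearsIn L C

theorem stepClause_append {L : List QUStep} {s : QUStep} {i : ℕ} {C : PA}
    (h : stepClause? L i = some C) : stepClause? (L ++ [s]) i = some C ∧ i < L.length := by
  have hi : i < L.length := by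
    by_contra hc
    simp [stepClause?, List.getElem?_eq_none (not_lt.mp hc)] at h
  refine ⟨?_, hi⟩
  rw [← h]; unfold stepClause?; rw [List.getElem?_append_left hi]

theorem valid_append {Φ : QBC} {H : Set PA} {L : List QUStep} {s : QUStep}
    (hL : IsQUProof Φ H L) (hs : validStep Φ.pfx H (L ++ [s]) L.length) :
    IsQUProof Φ H (L ++ [s]) := by
  intro i
  rcases lt_trichotomy i L.length with hi | hi | hi
  · have h := hL i
    unfold validStep at h ⊢
    rw [List.getElem?_append_left hi]
    rcases hq : L[i]? with _ | (C | ⟨C, j⟩ | ⟨C, j, k, v⟩)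
    · trivial
    · simpa [hq] using h
    · simp only [hq] at h ⊢
      obtain ⟨h1, D, h2, h3⟩ := h
      exact ⟨h1, D, (stepClause_append h2).1, h3⟩
    · simp only [hq] at h ⊢
      obtain ⟨h1, h1', D, E, h2, h2', h3⟩ := h
      exact ⟨h1, h1', D, E, (stepClause_append h2).1, (stepClause_append h2').1, h3⟩
  · subst hi; exact hs
  · unfold validStep
    rw [List.getElem?_eq_none (by simp; omega)]
    trivial

theorem reach_append {Φ : QBC} {H : Set PA} {L : List QUStep} {s : QUStep} {m : ℕ} {S : Set PA}
    (hL : IsQUProof Φ H L) (hm : L.length ≤ m) (hS : ∀ C ∈ S, AppearsIn L C)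
    (hs : validStep Φ.pfx H (L ++ [s]) L.length) : Reach Φ H (m + 1) (insert s.clause S) := by
  refine ⟨L ++ [s], valid_append hL hs, by simp; omega, ?_⟩
  rintro C (rfl | hC)
  · exact ⟨L.length, by simp [stepClause?]⟩
  · obtain ⟨i, hi⟩ := hS C hC
    exact ⟨i, (stepClause_append hi).1⟩

theorem Reach.ax {Φ : QBC} {H : Set PA} {m : ℕ} {S : Set PA} (h : Reach Φ H m S) {C : PA}
    (hC : C ∈ H) : Reach Φ H (m + 1) (insert C S) := by
  obtain ⟨L, h1, h2, h3⟩ := h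
  refine reach_append (s := .ax C) h1 h2 h3 ?_
  simpa [validStep] using hC

theorem Reach.elim {Φ : QBC} {H : Set PA} {m : ℕ} {S : Set PA} (h : Reach Φ H m S) {C D : PA}
    (hD : D ∈ S) (hC : ForallElim Φ.pfx C D) : Reach Φ H (m + 1) (insert C S) := by
  obtain ⟨L, h1, h2, h3⟩ := h
  obtain ⟨i, hi⟩ := h3 D hD
  refine reach_append (s := .elim C i) h1 h2 h3 ?_
  obtain ⟨a, b⟩ := stepClause_append (s := .elim C i) hi
  simpa [validStep] using ⟨b, D, a, hC⟩

theorem Reach.res {Φ : QBC} {H : Set PA} {m : ℕ} {S : Set PA} (h : Reach Φ H m S) {C D E : PA}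
    {v : ℕ} (hD : D ∈ S) (hE : E ∈ S) (hC : IsResolvent C D E v) :
    Reach Φ H (m + 1) (insert C S) := by
  obtain ⟨L, h1, h2, h3⟩ := h
  obtain ⟨i, hi⟩ := h3 D hD
  obtain ⟨j, hj⟩ := h3 E hE
  refine reach_append (s := .res C i j v) h1 h2 h3 ?_
  obtain ⟨a, b⟩ := stepClause_append (s := .res C i j v) hi
  obtain ⟨a', b'⟩ := stepClause_append (s := .res C i j v) hj
  simpa [validStep] using ⟨b, b', D, a, E, a', hC⟩

theorem Reach.mono {Φ : QBC} {H : Set PA} {m m' : ℕ} {S S' : Set PA} (h : Reach Φ H m S)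
    (hm : m ≤ m') (hS : S' ⊆ S) : Reach Φ H m' S' := by
  obtain ⟨L, h1, h2, h3⟩ := h
  exact ⟨L, h1, h2.trans hm, fun C hC => h3 C (hS hC)⟩

theorem Reach.falsity {Φ : QBC} {H : Set PA} {m : ℕ} {S : Set PA} (h : Reach Φ H m S)
    (he : emptyPA ∈ S) : ∃ L, IsFalsityProof Φ H L ∧ L.length ≤ m := by
  obtain ⟨L, h1, h2, h3⟩ := h
  obtain ⟨i, hi⟩ := h3 _ he
  have hil : i < L.length := (stepClause_append (s := .ax emptyPA) hi).2
  refine ⟨L.take (i + 1), ⟨?_, ?_⟩, by simp; omega⟩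
  · have key : ∀ j, j < i + 1 → (L.take (i + 1))[j]? = L[j]? := fun j hj => by
      rw [List.getElem?_take_of_lt hj]
    intro j
    by_cases hj : j < i + 1
    · have h := h1 j
      unfold validStep at h ⊢
      rw [key j hj]
      rcases hq : L[j]? with _ | (C | ⟨C, k⟩ | ⟨C, k, l, v⟩)
      · trivial
      · simpa [hq] using h
      · simp only [hq] at h ⊢
        obtain ⟨a, D, b, c⟩ := h
        exact ⟨a, D, by unfold stepClause? at b ⊢; rw [key k (by omega)]; exact b, c⟩
      · simp only [hq] at h ⊢
        obtain ⟨a, a', D, E, b, b', c⟩ := h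
        exact ⟨a, a', D, E, by unfold stepClause? at b ⊢; rw [key k (by omega)]; exact b,
          by unfold stepClause? at b' ⊢; rw [key l (by omega)]; exact b', c⟩
    · unfold validStep
      rw [List.getElem?_eq_none (by simp; omega)]
      trivial
  · rw [List.getLast?_eq_getElem?]
    have : (L.take (i + 1)).length - 1 = i := by simp; omega
    rw [this, List.getElem?_take_of_lt (by omega)]
    exact hi

/-- The variables `x'_{i+1,j,k}` precede `y_{i+1}`, which is universal. -/
theorem sep_split {n i : ℕ} (hi : i < n) : ∃ s t, sepPrefix n =
    s ++ (blockOf Quant.ex (xV' (i + 1)) ++ (Quant.all, yV (i + 1)) :: t) := by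
  obtain ⟨s, t, h⟩ := List.append_of_mem (List.mem_range.mpr hi)
  unfold sepPrefix
  rw [h, List.flatMap_append, List.flatMap_cons]
  exact ⟨_, _, by simp only [List.append_assoc, List.singleton_append, List.cons_append]; rw [← List.append_assoc]⟩

theorem y_univ {n i : ℕ} (hi : i < n) : yV (i + 1) ∈ univVars (sepPrefix n) := by
  obtain ⟨s, t, h⟩ := sep_split hi
  rw [h]
  simp [univVars]

theorem xprime_prec {n i : ℕ} (hi : i < n) (j k : Bool) :
    preceq (sepPrefix n) (xV' (i + 1) j k) (yV (i + 1)) := by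
  obtain ⟨s, t, h⟩ := sep_split hi
  rw [h]
  refine ⟨s.length + (2 * cond j 1 0 + cond k 1 0), s.length + 4, ?_, ?_, Or.inl ?_⟩
  · rw [List.getElem?_append_right (by omega), Nat.add_sub_cancel_left]
    cases j <;> cases k <;> simp [blockOf]
  · rw [List.getElem?_append_right (by omega), Nat.add_sub_cancel_left]
    simp [blockOf]
  · cases j <;> cases k <;> simp

/-- `x_{i,j,1} ∨ y^j ∨ x'_{i,j,0}`. -/
def cR1 (i : ℕ) (j : Bool) : PA := fun v =>
  if v = xV i j true ∨ v = xV' i j false then some false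
  else if v = yV i then some j else none

/-- `y^j ∨ x'_{i,j,0} ∨ x'_{i,j,1}`. -/
def cR2 (i : ℕ) (j : Bool) : PA := fun v =>
  if v = xV' i j true ∨ v = xV' i j false then some false
  else if v = yV i then some j else none

/-- `x'_{i,j,0} ∨ x'_{i,j,1}`. -/
def cW (i : ℕ) (j : Bool) : PA := fun v =>
  if v = xV' i j true ∨ v = xV' i j false then some false else none

/-- `x'_{i+1,0,1} ∨ ¬x'_{i+1,1,l} ∨ x_{i,j,0} ∨ x_{i,j,1}`. -/
def cS1 (i : ℕ) (j l : Bool) : PA := fun v =>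
  if v = xV' (i + 1) true l then some true
  else if v = xV' (i + 1) false true ∨ v = xV i j false ∨ v = xV i j true then some false
  else none

/-- `¬x'_{i+1,1,l} ∨ x_{i,j,0} ∨ x_{i,j,1}`. -/
def cS2 (i : ℕ) (j l : Bool) : PA := fun v =>
  if v = xV' (i + 1) true l then some true
  else if v = xV i j false ∨ v = xV i j true then some false
  else none

/-- `x'_{i+1,1,1} ∨ x_{i,j,0} ∨ x_{i,j,1}`. -/
def cS3 (i : ℕ) (j : Bool) : PA := fun v =>
  if v = xV' (i + 1) true true ∨ v = xV i j false ∨ v = xV i j true then some false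
  else none

/-- `x_{0,0,1}`. -/
def cZ : PA := fun v => if v = xV 0 false true then some false else none

theorem res_R1 (i : ℕ) (j : Bool) :
    IsResolvent (cR1 i j) (clB2 i j) (clT i j false) (xV i j false) := by
  refine ⟨false, ?_, ?_, ?_, ?_, ?_⟩ <;> cases j <;>
    simp only [cR1, clB2, clT, xV, xV', yV, cond] <;> grind

theorem res_R2 (i : ℕ) (j : Bool) :
    IsResolvent (cR2 i j) (cR1 i j) (clT i j true) (xV i j true) := by
  refine ⟨false, ?_, ?_, ?_, ?_, ?_⟩ <;> cases j <;>
    simp only [cR1, cR2, clT, xV, xV', yV, cond] <;> grind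

theorem elim_W {n i : ℕ} (hi : i < n) (j : Bool) :
    ForallElim (sepPrefix n) (cW (i + 1) j) (cR2 (i + 1) j) := by
  refine ⟨yV (i + 1), j, y_univ hi, ?_, ?_, ?_⟩
  · cases j <;> simp [cW, xV', yV]
  · funext u
    cases j <;> simp only [cW, cR2, Function.update_apply, xV', yV, cond] <;> grind
  · intro u hu
    have : u = xV' (i + 1) j true ∨ u = xV' (i + 1) j false := by
      by_contra hc
      exact hu (if_neg hc)
    rcases this with rfl | rfl <;> exact xprime_prec hi _ _

theorem res_S1 (i : ℕ) (j l : Bool) :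
    IsResolvent (cS1 i j l) (cW (i + 1) false) (clH (i + 1) j false l)
      (xV' (i + 1) false false) := by
  refine ⟨false, ?_, ?_, ?_, ?_, ?_⟩ <;> cases j <;> cases l <;>
    simp only [cS1, cW, clH, xV, xV', yV, cond, Nat.add_sub_cancel] <;> grind

theorem res_S2 (i : ℕ) (j l : Bool) :
    IsResolvent (cS2 i j l) (cS1 i j l) (clH (i + 1) j true l)
      (xV' (i + 1) false true) := by
  refine ⟨false, ?_, ?_, ?_, ?_, ?_⟩ <;> cases j <;> cases l <;>
    simp only [cS1, cS2, clH, xV, xV', yV, cond, Nat.add_sub_cancel] <;> grind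

theorem res_S3 (i : ℕ) (j : Bool) :
    IsResolvent (cS3 i j) (cW (i + 1) true) (cS2 i j false) (xV' (i + 1) true false) := by
  refine ⟨false, ?_, ?_, ?_, ?_, ?_⟩ <;> cases j <;>
    simp only [cS2, cS3, cW, xV, xV', yV, cond] <;> grind

theorem res_A (i : ℕ) (j : Bool) :
    IsResolvent (clB2 i j) (cS3 i j) (cS2 i j true) (xV' (i + 1) true true) := by
  refine ⟨false, ?_, ?_, ?_, ?_, ?_⟩ <;> cases j <;>
    simp only [cS2, cS3, clB2, xV, xV', yV, cond] <;> grind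

theorem res_Z : IsResolvent cZ (clB2 0 false) (clB1 false false) (xV 0 false false) := by
  refine ⟨false, ?_, ?_, ?_, ?_, ?_⟩ <;>
    simp only [cZ, clB2, clB1, xV, cond] <;> grind

theorem res_E : IsResolvent emptyPA cZ (clB1 false true) (xV 0 false true) := by
  refine ⟨false, ?_, ?_, ?_, ?_, ?_⟩ <;>
    simp only [cZ, emptyPA, clB1, xV, cond] <;> grind

theorem mem_T {n i : ℕ} (hi : i < n) (j k : Bool) : clT (i + 1) j k ∈ sepClauses n :=
  Or.inr (Or.inr (Or.inr ⟨i + 1, by omega, by omega, j, k, rfl⟩))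

theorem mem_H {n i : ℕ} (hi : i < n) (j k l : Bool) : clH (i + 1) j k l ∈ sepClauses n :=
  Or.inr (Or.inr (Or.inl ⟨i + 1, by omega, by omega, j, k, l, rfl⟩))

theorem reach_W {n i m : ℕ} {S : Set PA} (hi : i < n) (j : Bool)
    (h : Reach (sepQBC n) (sepClauses n) m S) (hA : clB2 (i + 1) j ∈ S) :
    Reach (sepQBC n) (sepClauses n) (m + 5) (insert (cW (i + 1) j) S) := by
  have h1 := h.ax (mem_T hi j false)
  have h2 := h1.res (by simp [hA]) (by simp) (res_R1 (i + 1) j)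
  have h3 := h2.ax (mem_T hi j true)
  have h4 := h3.res (by simp) (by simp) (res_R2 (i + 1) j)
  have h5 := h4.elim (by simp) (elim_W hi j)
  exact h5.mono le_rfl (by intro C; simp only [Set.mem_insert_iff]; tauto)

theorem reach_S2 {n i m : ℕ} {S : Set PA} (hi : i < n) (j l : Bool)
    (h : Reach (sepQBC n) (sepClauses n) m S) (hA : cW (i + 1) false ∈ S) :
    Reach (sepQBC n) (sepClauses n) (m + 4) (insert (cS2 i j l) S) := by
  have h1 := h.ax (mem_H hi j false l)
  have h2 := h1.res (by simp [hA]) (by simp) (res_S1 i j l)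
  have h3 := h2.ax (mem_H hi j true l)
  have h4 := h3.res (by simp) (by simp) (res_S2 i j l)
  exact h4.mono le_rfl (by intro C; simp only [Set.mem_insert_iff]; tauto)

theorem reach_A {n i m : ℕ} {S : Set PA} (hi : i < n) (j : Bool)
    (h : Reach (sepQBC n) (sepClauses n) m S) (hA : cW (i + 1) false ∈ S)
    (hB : cW (i + 1) true ∈ S) :
    Reach (sepQBC n) (sepClauses n) (m + 10) (insert (clB2 i j) S) := by
  have h1 := reach_S2 hi j false h hA
  have h2 := reach_S2 hi j true h1 (by simp [hA])
  have h3 := h2.res (by simp [hB]) (by simp) (res_S3 i j)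
  have h4 := h3.res (by simp) (by simp) (res_A i j)
  exact h4.mono le_rfl (by intro C; simp only [Set.mem_insert_iff]; tauto)

theorem reach_level {n : ℕ} : ∀ d i : ℕ, i + d = n →
    Reach (sepQBC n) (sepClauses n) (30 * d + 2) {clB2 i false, clB2 i true} := by
  intro d
  induction d with
  | zero =>
    intro i hi
    obtain rfl : i = n := by omega
    have h0 : Reach (sepQBC i) (sepClauses i) 0 ∅ :=
      ⟨[], fun i => by simp [validStep], by simp, by simp⟩
    have h1 := h0.ax (C := clB2 i false) (Or.inr (Or.inl ⟨_, rfl⟩))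
    have h2 := h1.ax (C := clB2 i true) (Or.inr (Or.inl ⟨_, rfl⟩))
    exact h2.mono (by omega) (by intro C; simp only [Set.mem_insert_iff, Set.mem_singleton_iff]; tauto)
  | succ d ih =>
    intro i hi
    have hn : i < n := by omega
    have h0 := ih (i + 1) (by omega)
    have h1 := reach_W hn false h0 (by simp)
    have h2 := reach_W hn true h1 (by simp)
    have h3 := reach_A hn false h2 (by simp) (by simp)
    have h4 := reach_A hn true h3 (by simp) (by simp)
    exact h4.mono (by omega) (by intro C; simp only [Set.mem_insert_iff, Set.mem_singleton_iff]; tauto)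

/-- Proposition 6.1: the separation formulas `Φₙ` have
QU-resolution falsity proofs, from the clauses of `φₙ`, of size linear
in `n`. -/
theorem sep_linear_size_proofs :
    ∃ c : ℕ, ∀ n : ℕ, 1 ≤ n → ∃ L : List QUStep,
      IsFalsityProof (sepQBC n) (sepClauses n) L ∧ L.length ≤ c * n := by
  refine ⟨36, fun n hn => ?_⟩
  have h0 := reach_level (n := n) n 0 (by omega)
  have h1 := h0.ax (C := clB1 false false) (Or.inl ⟨_, _, rfl⟩)
  have h2 := h1.res (by simp) (by simp) res_Z
  have h3 := h2.ax (C := clB1 false true) (Or.inl ⟨_, _, rfl⟩)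
  have h4 := h3.res (by simp) (by simp) res_E
  obtain ⟨L, hL, hl⟩ := h4.falsity (by simp)
  exact ⟨L, hL, by omega⟩
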